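/- Let λ* = λ*(q,p) be the bifurcation value of the family x' = −x² + q(t)x + p(t) + λ. For λ = λ*, the globally defined bounded solutions a_{λ*} and r_{λ*} satisfy inf_{t∈ℝ}(a_{λ*}(t) − r_{λ*}(t)) = 0, and the equation x' = −x² + q(t)x + p(t) + λ* has no hyperbolic solutions. -/

import Mathlib

open Set Filter

/-- The right-hand side of the quadratic equation `x' = -x² + Q(t)x + P(t)`. -/
def quadF (Q P : ℝ → ℝ) : ℝ → ℝ → ℝ := fun t x => -x ^ 2 + Q t * x + P t

/-- `b` is a globally defined bounded solution of `x' = -x² + Q(t)x + P(t)`. -/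
def IsBddSol (Q P b : ℝ → ℝ) : Prop :=
  (∀ t, HasDerivAt b (quadF Q P t (b t)) t) ∧ ∃ C, ∀ t, |b t| ≤ C

/-- `(k, β)` is a dichotomy constant pair witnessing that the variational equation
`z' = (-2 b(t) + Q(t)) z` is Hurwitz at `+∞` (attractive case). -/
def AttrDich (Q b : ℝ → ℝ) (k β : ℝ) : Prop :=
  1 ≤ k ∧ 0 < β ∧ ∀ s t : ℝ, s ≤ t →
    Real.exp (∫ l in s..t, (-2 * b l + Q l)) ≤ k * Real.exp (-β * (t - s))

/-- `(k, β)` is a dichotomy constant pair witnessing that the variational equation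
`z' = (-2 b(t) + Q(t)) z` is Hurwitz at `−∞` (repulsive case). -/
def RepDich (Q b : ℝ → ℝ) (k β : ℝ) : Prop :=
  1 ≤ k ∧ 0 < β ∧ ∀ s t : ℝ, t ≤ s →
    Real.exp (∫ l in s..t, (-2 * b l + Q l)) ≤ k * Real.exp (β * (t - s))

/-- `b` is an attractive hyperbolic solution of `x' = -x² + Q(t)x + P(t)`. -/
def IsAttrHyp (Q P b : ℝ → ℝ) : Prop := IsBddSol Q P b ∧ ∃ k β : ℝ, AttrDich Q b k β

/-- `b` is a repulsive hyperbolic solution of `x' = -x² + Q(t)x + P(t)`. -/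
def IsRepHyp (Q P b : ℝ → ℝ) : Prop := IsBddSol Q P b ∧ ∃ k β : ℝ, RepDich Q b k β

/-- `b` is a hyperbolic solution of `x' = -x² + Q(t)x + P(t)`. -/
def IsHyp (Q P b : ℝ → ℝ) : Prop := IsAttrHyp Q P b ∨ IsRepHyp Q P b

/-- The supremum norm distance between `f` and `g` is `< δ`. -/
def SupLt (f g : ℝ → ℝ) (δ : ℝ) : Prop := ∃ d : ℝ, d < δ ∧ ∀ t, |f t - g t| ≤ d

/-- The family of maximal solutions `t ↦ X t s x₀` of the scalar ODE `x' = h (t, x)`. -/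
structure MaxSolFamily (h : ℝ → ℝ → ℝ) where
  X : ℝ → ℝ → ℝ → ℝ
  dom : ℝ → ℝ → Set ℝ
  dom_open : ∀ s x₀, IsOpen (dom s x₀)
  dom_ordConn : ∀ s x₀, (dom s x₀).OrdConnected
  mem_dom : ∀ s x₀, s ∈ dom s x₀
  init : ∀ s x₀, X s s x₀ = x₀
  sol : ∀ s x₀, ∀ t ∈ dom s x₀, HasDerivAt (fun τ => X τ s x₀) (h t (X t s x₀)) t
  maximal : ∀ s x₀ (y : ℝ → ℝ) (I : Set ℝ), IsOpen I → I.OrdConnected → s ∈ I →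
      y s = x₀ → (∀ t ∈ I, HasDerivAt y (h t (y t)) t) →
      I ⊆ dom s x₀ ∧ ∀ t ∈ I, y t = X t s x₀

/-- The solution `X · s x₀` is (defined and) bounded as `t → −∞`. -/
def BddAtBot {h : ℝ → ℝ → ℝ} (F : MaxSolFamily h) (s x₀ : ℝ) : Prop :=
  ∃ C : ℝ, ∀ᶠ t in atBot, t ∈ F.dom s x₀ ∧ |F.X t s x₀| ≤ C

/-- The solution `X · s x₀` is (defined and) bounded as `t → ∞`. -/
def BddAtTop {h : ℝ → ℝ → ℝ} (F : MaxSolFamily h) (s x₀ : ℝ) : Prop :=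
  ∃ C : ℝ, ∀ᶠ t in atTop, t ∈ F.dom s x₀ ∧ |F.X t s x₀| ≤ C

/-- `a` is the globally defined bounded solution characterized by:
`X · s x₀` is bounded as `t → −∞` iff `x₀ ≤ a s`. -/
def CharA {h : ℝ → ℝ → ℝ} (F : MaxSolFamily h) (a : ℝ → ℝ) : Prop :=
  (∀ t, HasDerivAt a (h t (a t)) t) ∧ (∃ C, ∀ t, |a t| ≤ C) ∧
  ∀ s x₀ : ℝ, BddAtBot F s x₀ ↔ x₀ ≤ a s

/-- `r` is the globally defined bounded solution characterized by:
`X · s x₀` is bounded as `t → ∞` iff `x₀ ≥ r s`. -/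
def CharR {h : ℝ → ℝ → ℝ} (F : MaxSolFamily h) (r : ℝ → ℝ) : Prop :=
  (∀ t, HasDerivAt r (h t (r t)) t) ∧ (∃ C, ∀ t, |r t| ≤ C) ∧
  ∀ s x₀ : ℝ, BddAtTop F s x₀ ↔ r s ≤ x₀

/-- The field is at most `-1` outside `[-(B+1), B+1]` when the coefficients are bounded by `B`. -/
lemma quadF_le_neg_one {Q P : ℝ → ℝ} {B : ℝ} (hQ : ∀ t, |Q t| ≤ B) (hP : ∀ t, |P t| ≤ B)
    {x : ℝ} (hx : B + 1 ≤ |x|) (t : ℝ) : quadF Q P t x ≤ -1 := by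
  have hB : 0 ≤ B := (abs_nonneg _).trans (hQ t)
  have h1 : Q t * x ≤ B * |x| :=
    (le_abs_self _).trans (by rw [abs_mul]; exact mul_le_mul_of_nonneg_right (hQ t) (abs_nonneg _))
  have h2 := (le_abs_self _).trans (hP t)
  have h3 : x ^ 2 = |x| ^ 2 := (sq_abs x).symm
  unfold quadF
  nlinarith

lemma abs_quadF_le {Q P : ℝ → ℝ} {B : ℝ} (hQ : ∀ t, |Q t| ≤ B) (hP : ∀ t, |P t| ≤ B)
    {x D : ℝ} (hx : |x| ≤ D) (t : ℝ) : |quadF Q P t x| ≤ D ^ 2 + B * D + B := by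
  have hB : 0 ≤ B := (abs_nonneg _).trans (hQ t)
  have h1 : |Q t * x| ≤ B * D := by
    rw [abs_mul]; exact mul_le_mul (hQ t) hx (abs_nonneg _) hB
  have h2 : |-x ^ 2| ≤ D ^ 2 := by
    rw [abs_neg, abs_pow]; exact pow_le_pow_left₀ (abs_nonneg _) hx 2
  calc |quadF Q P t x| ≤ |-x ^ 2 + Q t * x| + |P t| := abs_add_le _ _
    _ ≤ |-x ^ 2| + |Q t * x| + |P t| := by gcongr; exact abs_add_le _ _
    _ ≤ _ := by gcongr; exact hP t

/-- A subsolution starting below a supersolution stays below it. -/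
lemma le_of_subsolution_of_supersolution {Q P u u' v v' : ℝ → ℝ} {B s t : ℝ}
    (hQ : ∀ t, |Q t| ≤ B) (hst : s ≤ t)
    (hu : ∀ τ ∈ Icc s t, HasDerivAt u (u' τ) τ) (hv : ∀ τ ∈ Icc s t, HasDerivAt v (v' τ) τ)
    (hu' : ∀ τ ∈ Icc s t, u' τ ≤ quadF Q P τ (u τ))
    (hv' : ∀ τ ∈ Icc s t, quadF Q P τ (v τ) ≤ v' τ) (h : u s ≤ v s) : u t ≤ v t := by
  have hcu : ContinuousOn u (Icc s t) := fun τ hτ => (hu τ hτ).continuousAt.continuousWithinAt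
  have hcv : ContinuousOn v (Icc s t) := fun τ hτ => (hv τ hτ).continuousAt.continuousWithinAt
  obtain ⟨Cu, hCu⟩ := isCompact_Icc.exists_bound_of_continuousOn hcu
  obtain ⟨Cv, hCv⟩ := isCompact_Icc.exists_bound_of_continuousOn hcv
  set L := Cu + Cv + B + 1 with hL
  have key : ∀ ε > 0, u t ≤ v t + ε * Real.exp (L * (t - s)) := by
    intro ε hε
    have hE : ∀ τ, HasDerivAt (fun τ => ε * Real.exp (L * (τ - s)))
        (ε * (Real.exp (L * (τ - s)) * L)) τ := by
      intro τ
      have h1 : HasDerivAt (fun τ => L * (τ - s)) L τ := by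
        simpa using ((hasDerivAt_id τ).sub_const s).const_mul L
      exact h1.exp.const_mul ε
    have hw : ∀ τ ∈ Icc s t, HasDerivAt (fun τ => v τ + ε * Real.exp (L * (τ - s)))
        (v' τ + ε * (Real.exp (L * (τ - s)) * L)) τ := fun τ hτ => (hv τ hτ).add (hE τ)
    refine image_le_of_deriv_right_lt_deriv_boundary' hcu
      (fun τ hτ => (hu τ (Ico_subset_Icc_self hτ)).hasDerivWithinAt)
      (B := fun τ => v τ + ε * Real.exp (L * (τ - s))) ?_
      (fun τ hτ => (hw τ hτ).continuousAt.continuousWithinAt)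
      (fun τ hτ => (hw τ (Ico_subset_Icc_self hτ)).hasDerivWithinAt) ?_ (right_mem_Icc.2 hst)
    · simp only [sub_self, mul_zero, Real.exp_zero, mul_one]; linarith
    · intro τ hτ he
      have hτ' := Ico_subset_Icc_self hτ
      have a1 := hu' τ hτ'
      have a2 := hv' τ hτ'
      have a3 := abs_le.1 (hCu τ hτ')
      have a4 := abs_le.1 (hCv τ hτ')
      have a5 := abs_le.1 (hQ τ)
      set e := ε * Real.exp (L * (τ - s)) with he'
      have hepos : 0 < e := mul_pos hε (Real.exp_pos _)
      have a6 : quadF Q P τ (u τ) - quadF Q P τ (v τ) = e * (-(u τ + v τ) + Q τ) := by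
        have : e = u τ - v τ := by rw [he]; ring
        rw [this]; unfold quadF; ring
      have a7 : e * (-(u τ + v τ) + Q τ) < e * L := by
        apply mul_lt_mul_of_pos_left _ hepos
        rw [hL]; linarith [a3.1, a4.1, a5.2]
      have a8 : ε * (Real.exp (L * (τ - s)) * L) = e * L := by rw [he']; ring
      rw [a8]; linarith
  refine le_of_forall_pos_le_add fun ε hε => ?_
  have := key (ε / Real.exp (L * (t - s))) (div_pos hε (Real.exp_pos _))
  rwa [div_mul_cancel₀ _ (Real.exp_pos _).ne'] at this

/-- Uniform time of existence for initial data in `[-C, C]`. -/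
lemma MaxSolFamily.exists_Ioo_subset_dom {Q P : ℝ → ℝ} {B : ℝ} (F : MaxSolFamily (quadF Q P))
    (hQc : Continuous Q) (hPc : Continuous P)
    (hQ : ∀ t, |Q t| ≤ B) (hP : ∀ t, |P t| ≤ B) (C : ℝ) :
    ∃ ε > 0, ∀ s x₀, |x₀| ≤ C → Ioo (s - ε) (s + ε) ⊆ F.dom s x₀ := by
  have hB : 0 ≤ B := (abs_nonneg _).trans (hQ 0)
  set D := |C| + 1 with hD
  have hD0 : 0 < D := by positivity
  set L := D ^ 2 + B * D + B with hL
  have hL0 : 0 < L := by positivity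
  refine ⟨1 / L, by positivity, fun s x₀ hx₀ => ?_⟩
  have hε : 0 < 1 / L := by positivity
  have hball : ∀ x ∈ Metric.closedBall x₀ ((1 : NNReal) : ℝ), |x| ≤ D := by
    intro x hx
    rw [Metric.mem_closedBall, Real.dist_eq, NNReal.coe_one] at hx
    have h1 : |x| ≤ |x - x₀| + |x₀| := by simpa using abs_add_le (x - x₀) x₀
    linarith [le_abs_self C]
  have hPL : IsPicardLindelof (quadF Q P) (tmin := s - 1 / L) (tmax := s + 1 / L)
      ⟨s, by constructor <;> linarith⟩ x₀ 1 0 (NNReal.mk L hL0.le) (NNReal.mk (2 * D + B) (by positivity)) :=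
    { lipschitzOnWith := by
        intro t _
        refine LipschitzOnWith.of_dist_le_mul fun x hx y hy => ?_
        rw [Real.dist_eq, Real.dist_eq, NNReal.coe_mk]
        have : quadF Q P t x - quadF Q P t y = (-(x + y) + Q t) * (x - y) := by unfold quadF; ring
        rw [this, abs_mul]
        gcongr
        have := abs_le.1 (hball x hx)
        have := abs_le.1 (hball y hy)
        have := abs_le.1 (hQ t)
        rw [abs_le]; constructor <;> linarith
      continuousOn := by
        intro x _
        unfold quadF
        fun_prop
      norm_le := by
        intro t _ x hx
        exact abs_quadF_le hQ hP (hball x hx) t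
      mul_max_le := by
        simp
        field_simp
        rfl }
  obtain ⟨y, hy0, hy⟩ := hPL.exists_eq_forall_mem_Icc_hasDerivWithinAt₀
  refine (F.maximal s x₀ y _ isOpen_Ioo ordConnected_Ioo ⟨by linarith, by linarith⟩ hy0 ?_).1
  intro t ht
  exact (hy t (Ioo_subset_Icc_self ht)).hasDerivAt (Icc_mem_nhds ht.1 ht.2)

lemma MaxSolFamily.dom_subset_dom {h : ℝ → ℝ → ℝ} (F : MaxSolFamily h) {s x₀ t : ℝ}
    (ht : t ∈ F.dom s x₀) : F.dom t (F.X t s x₀) ⊆ F.dom s x₀ := by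
  obtain ⟨h1, h2⟩ := F.maximal t (F.X t s x₀) (fun τ => F.X τ s x₀) (F.dom s x₀)
    (F.dom_open _ _) (F.dom_ordConn _ _) ht rfl (F.sol s x₀)
  refine (F.maximal s x₀ (fun τ => F.X τ t (F.X t s x₀)) _ (F.dom_open _ _) (F.dom_ordConn _ _)
    (h1 (F.mem_dom _ _)) ?_ (F.sol _ _)).1
  rw [← h2 s (F.mem_dom _ _), F.init]

/-- A solution which stays bounded in the future is defined in the whole future. -/
lemma MaxSolFamily.Ici_subset_dom {Q P : ℝ → ℝ} {B : ℝ} (F : MaxSolFamily (quadF Q P))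
    (hQc : Continuous Q) (hPc : Continuous P)
    (hQ : ∀ t, |Q t| ≤ B) (hP : ∀ t, |P t| ≤ B) {s x₀ C : ℝ}
    (hb : ∀ t ∈ F.dom s x₀, s ≤ t → |F.X t s x₀| ≤ C) : Ici s ⊆ F.dom s x₀ := by
  obtain ⟨ε, hε, H⟩ := F.exists_Ioo_subset_dom hQc hPc hQ hP C
  have step : ∀ n : ℕ, s + n * (ε / 2) ∈ F.dom s x₀ := by
    intro n
    induction n with
    | zero => simpa using F.mem_dom s x₀
    | succ k ih =>
      have hk : s ≤ s + k * (ε / 2) := by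
        have : 0 ≤ k * (ε / 2) := by positivity
        linarith
      refine F.dom_subset_dom ih (H _ _ (hb _ ih hk) ?_)
      push_cast
      constructor <;> linarith
  intro t ht
  obtain ⟨n, hn⟩ := exists_nat_ge ((t - s) / (ε / 2))
  rw [div_le_iff₀ (by positivity)] at hn
  exact (F.dom_ordConn s x₀).out (F.mem_dom s x₀) (step n) ⟨ht, by linarith⟩

/-- A solution which stays bounded in the past is defined in the whole past. -/
lemma MaxSolFamily.Iic_subset_dom {Q P : ℝ → ℝ} {B : ℝ} (F : MaxSolFamily (quadF Q P))
    (hQc : Continuous Q) (hPc : Continuous P)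
    (hQ : ∀ t, |Q t| ≤ B) (hP : ∀ t, |P t| ≤ B) {s x₀ C : ℝ}
    (hb : ∀ t ∈ F.dom s x₀, t ≤ s → |F.X t s x₀| ≤ C) : Iic s ⊆ F.dom s x₀ := by
  obtain ⟨ε, hε, H⟩ := F.exists_Ioo_subset_dom hQc hPc hQ hP C
  have step : ∀ n : ℕ, s - n * (ε / 2) ∈ F.dom s x₀ := by
    intro n
    induction n with
    | zero => simpa using F.mem_dom s x₀
    | succ k ih =>
      have hk : s - k * (ε / 2) ≤ s := by
        have : 0 ≤ k * (ε / 2) := by positivity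
        linarith
      refine F.dom_subset_dom ih (H _ _ (hb _ ih hk) ?_)
      push_cast
      constructor <;> linarith
  intro t ht
  obtain ⟨n, hn⟩ := exists_nat_ge ((s - t) / (ε / 2))
  rw [div_le_iff₀ (by positivity)] at hn
  exact (F.dom_ordConn s x₀).out (step n) (F.mem_dom s x₀) ⟨by linarith, ht⟩

/-- Pointwise limits of eventually-solutions that are bounded on the whole line are solutions. -/
lemma hasDerivAt_of_tendsto_of_bounded {Q P a : ℝ → ℝ} {B D : ℝ} {y : ℕ → ℝ → ℝ}
    (hQc : Continuous Q) (hPc : Continuous P)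
    (hQ : ∀ t, |Q t| ≤ B) (hP : ∀ t, |P t| ≤ B)
    (hyc : ∀ n, Continuous (y n)) (hyb : ∀ n t, |y n t| ≤ D)
    (hy : ∀ T : ℝ, ∀ᶠ n in atTop, ∀ t, T ≤ t → HasDerivAt (y n) (quadF Q P t (y n t)) t)
    (hlim : ∀ t, Tendsto (fun n => y n t) atTop (nhds (a t))) (t : ℝ) :
    HasDerivAt a (quadF Q P t (a t)) t := by
  set L := D ^ 2 + B * D + B with hL
  have hcomp : ∀ z : ℝ → ℝ, Continuous z → Continuous fun τ => quadF Q P τ (z τ) := by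
    intro z hz; unfold quadF; fun_prop
  have hintegral : ∀ s t, a t - a s = ∫ τ in s..t, quadF Q P τ (a τ) := by
    intro s t
    have h1 : Tendsto (fun n => y n t - y n s) atTop (nhds (a t - a s)) := (hlim t).sub (hlim s)
    have h2 : Tendsto (fun n => ∫ τ in s..t, quadF Q P τ (y n τ)) atTop
        (nhds (∫ τ in s..t, quadF Q P τ (a τ))) := by
      refine intervalIntegral.tendsto_integral_filter_of_dominated_convergence (fun _ => L)
        (Eventually.of_forall fun n => (hcomp _ (hyc n)).aestronglyMeasurable)
        (Eventually.of_forall fun n => Eventually.of_forall fun τ _ => abs_quadF_le hQ hP (hyb n τ) τ)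
        intervalIntegrable_const (Eventually.of_forall fun τ _ => ?_)
      have hq : Continuous (quadF Q P τ) := by unfold quadF; fun_prop
      exact (hq.tendsto _).comp (hlim τ)
    refine tendsto_nhds_unique h1 (h2.congr' ?_)
    filter_upwards [hy (min s t)] with n hn
    exact intervalIntegral.integral_eq_sub_of_hasDerivAt (fun τ hτ => hn τ hτ.1)
      ((hcomp _ (hyc n)).intervalIntegrable _ _)
  have hab : ∀ t, |a t| ≤ D := fun t =>
    le_of_tendsto (hlim t).abs (Eventually.of_forall fun n => hyb n t)
  have hac : Continuous a := by
    refine LipschitzWith.continuous (K := Real.toNNReal L) (LipschitzWith.of_dist_le' fun t s => ?_)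
    rw [Real.dist_eq, Real.dist_eq, hintegral s t]
    exact intervalIntegral.norm_integral_le_of_norm_le_const (C := L)
      (f := fun τ => quadF Q P τ (a τ)) fun τ _ => abs_quadF_le hQ hP (hab τ) τ
  have h3 : HasDerivAt (fun t => ∫ τ in (0 : ℝ)..t, quadF Q P τ (a τ)) (quadF Q P t (a t)) t :=
    intervalIntegral.integral_hasDerivAt_right ((hcomp _ hac).intervalIntegrable _ _)
      ((hcomp _ hac).stronglyMeasurableAtFilter _ _) (hcomp _ hac).continuousAt
  have h4 : a = fun t => a 0 + ∫ τ in (0 : ℝ)..t, quadF Q P τ (a τ) := by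
    funext t; rw [← hintegral 0 t]; ring
  have h5 := h3.const_add (a 0)
  rwa [← h4] at h5

/-- If a bounded subsolution exists, then so does the maximal bounded solution, and it
characterizes boundedness in the past. -/
lemma exists_charA_of_subsolution {Q P m m' : ℝ → ℝ} {B C : ℝ} (F : MaxSolFamily (quadF Q P))
    (hQc : Continuous Q) (hPc : Continuous P)
    (hQ : ∀ t, |Q t| ≤ B) (hP : ∀ t, |P t| ≤ B)
    (hm : ∀ t, HasDerivAt m (m' t) t) (hm' : ∀ t, m' t ≤ quadF Q P t (m t))
    (hmC : ∀ t, |m t| ≤ C) : ∃ a, CharA F a := by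
  have hB : 0 ≤ B := (abs_nonneg _).trans (hQ 0)
  set K := max (B + 1) C with hK
  have hKB : B + 1 ≤ K := le_max_left _ _
  have hKC : C ≤ K := le_max_right _ _
  have hK0 : 0 < K := by linarith
  have hconst : ∀ c : ℝ, B + 1 ≤ |c| → ∀ t, quadF Q P t c ≤ 0 := fun c hc t => by
    linarith [quadF_le_neg_one hQ hP hc t]
  have hmK : ∀ t, m t ≤ K := fun t => (le_abs_self _).trans ((hmC t).trans hKC)
  have hKm : ∀ t, -K ≤ m t := fun t => by linarith [(abs_le.1 (hmC t)).1]
  -- sign of the field along constants, as a comparison principle from above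
  have below : ∀ (x : ℝ → ℝ) (c s t : ℝ), B + 1 ≤ |c| → s ≤ t →
      (∀ τ ∈ Icc s t, HasDerivAt x (quadF Q P τ (x τ)) τ) → x s ≤ c → x t ≤ c :=
    fun x c s t hc hst hx h => le_of_subsolution_of_supersolution (v := fun _ => c)
      (v' := fun _ => 0) hQ hst hx (fun τ _ => hasDerivAt_const τ c) (fun _ _ => le_rfl)
      (fun τ _ => hconst c hc τ) h
  have hmdom : ∀ s, ∀ t ∈ F.dom s K, s ≤ t → m t ≤ F.X t s K ∧ F.X t s K ≤ K := by
    intro s t ht hst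
    have hsol : ∀ τ ∈ Icc s t, HasDerivAt (fun τ => F.X τ s K) (quadF Q P τ (F.X τ s K)) τ :=
      fun τ hτ => F.sol s K τ ((F.dom_ordConn s K).out (F.mem_dom s K) ht hτ)
    refine ⟨le_of_subsolution_of_supersolution hQ hst (fun τ _ => hm τ) hsol (fun τ _ => hm' τ)
      (fun _ _ => le_rfl) (by simpa [F.init] using hmK s), ?_⟩
    exact below (fun τ => F.X τ s K) K s t (hKB.trans (le_abs_self _)) hst hsol (F.init s K).le
  have hdom : ∀ s, Ici s ⊆ F.dom s K := fun s =>
    F.Ici_subset_dom hQc hPc hQ hP (C := K) fun t ht hst =>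
      abs_le.2 ⟨(hKm t).trans (hmdom s t ht hst).1, (hmdom s t ht hst).2⟩
  have hsol : ∀ s t, s ≤ t → HasDerivAt (fun τ => F.X τ s K) (quadF Q P t (F.X t s K)) t :=
    fun s t hst => F.sol s K t (hdom s hst)
  have hXm : ∀ s t, s ≤ t → m t ≤ F.X t s K := fun s t h => (hmdom s t (hdom s h) h).1
  have hXK : ∀ s t, s ≤ t → F.X t s K ≤ K := fun s t h => (hmdom s t (hdom s h) h).2
  -- comparison of a solution lying below `K` at time `s` with the solution through `(s, K)`
  have hcmp : ∀ (x : ℝ → ℝ) (s t : ℝ), s ≤ t →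
      (∀ τ ∈ Icc s t, HasDerivAt x (quadF Q P τ (x τ)) τ) → x s ≤ K → x t ≤ F.X t s K :=
    fun x s t hst hx h => le_of_subsolution_of_supersolution hQ hst hx
      (fun τ hτ => hsol s τ hτ.1) (fun _ _ => le_rfl) (fun _ _ => le_rfl) (by simpa [F.init] using h)
  set y : ℕ → ℝ → ℝ := fun n t => F.X (max t (-(n : ℝ))) (-(n : ℝ)) K with hy
  have hyt : ∀ n : ℕ, ∀ t, -(n : ℝ) ≤ t → y n t = F.X t (-(n : ℝ)) K := fun n t h => by
    simp only [hy, max_eq_left h]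
  have hyc : ∀ n, Continuous (y n) := by
    intro n
    have : ContinuousOn (fun τ => F.X τ (-(n : ℝ)) K) (Ici (-(n : ℝ))) := fun τ hτ =>
      (hsol _ τ hτ).continuousAt.continuousWithinAt
    exact this.comp_continuous (by fun_prop) fun t => mem_Ici.2 (le_max_right _ _)
  have hyK : ∀ n t, y n t ≤ K := fun n t => hXK _ _ (le_max_right _ _)
  have hyKm : ∀ n t, -K ≤ y n t := fun n t => (hKm _).trans (hXm _ _ (le_max_right _ _))
  have hyanti : ∀ t, Antitone fun n => y n t := by
    intro t n n' hnn
    have hc : -(n' : ℝ) ≤ -(n : ℝ) := neg_le_neg (by exact_mod_cast hnn)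
    rcases le_total (-(n : ℝ)) t with h | h
    · simp only [hyt n t h, hyt n' t (hc.trans h)]
      exact hcmp (fun τ => F.X τ (-(n' : ℝ)) K) _ _ h (fun τ hτ => hsol _ τ (hc.trans hτ.1))
        (hXK _ _ hc)
    · have : y n t = K := by simp only [hy, max_eq_right h, F.init]
      simpa only [this] using hyK n' t
  have hylim : ∀ t, Tendsto (fun n => y n t) atTop (nhds (⨅ n, y n t)) := fun t =>
    tendsto_atTop_ciInf (hyanti t) ⟨-K, by rintro _ ⟨n, rfl⟩; exact hyKm n t⟩
  set a : ℝ → ℝ := fun t => ⨅ n, y n t with ha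
  have hev : ∀ T : ℝ, ∀ᶠ n : ℕ in atTop, -(n : ℝ) < T := fun T => by
    obtain ⟨N, hN⟩ := exists_nat_gt (-T)
    filter_upwards [eventually_ge_atTop N] with n hn
    have : (N : ℝ) ≤ n := by exact_mod_cast hn
    linarith
  have hasol : ∀ t, HasDerivAt a (quadF Q P t (a t)) t := by
    refine hasDerivAt_of_tendsto_of_bounded (D := K) hQc hPc hQ hP hyc
      (fun n t => abs_le.2 ⟨hyKm n t, hyK n t⟩) (fun T => ?_) hylim
    filter_upwards [hev T] with n hn t ht
    rw [hyt n t (hn.le.trans ht)]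
    refine (hsol (-(n : ℝ)) t (hn.le.trans ht)).congr_of_eventuallyEq ?_
    filter_upwards [lt_mem_nhds (hn.trans_le ht)] with τ hτ
    exact hyt n τ hτ.le
  have haK : ∀ t, |a t| ≤ K := fun t =>
    le_of_tendsto (hylim t).abs (Eventually.of_forall fun n => abs_le.2 ⟨hyKm n t, hyK n t⟩)
  refine ⟨a, hasol, ⟨K, haK⟩, fun s x₀ => ⟨?_, ?_⟩⟩
  · rintro ⟨D, hD⟩
    obtain ⟨T, hT⟩ := eventually_atBot.1 hD
    have hdom' : ∀ t ≤ s, t ∈ F.dom s x₀ := fun t ht =>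
      (F.dom_ordConn s x₀).out (hT (min t T) (min_le_right _ _)).1 (F.mem_dom s x₀)
        ⟨min_le_left _ _, ht⟩
    have hx : ∀ t ≤ s, HasDerivAt (fun τ => F.X τ s x₀) (quadF Q P t (F.X t s x₀)) t :=
      fun t ht => F.sol s x₀ t (hdom' t ht)
    have hle : ∀ t ≤ s, F.X t s x₀ ≤ K := by
      by_contra! hcon
      obtain ⟨t₀, ht₀, hgt⟩ := hcon
      have hgt' : ∀ t ≤ t₀, K < F.X t s x₀ := fun t ht => by
        by_contra! h
        exact hgt.not_ge (below (fun τ => F.X τ s x₀) K t t₀ (hKB.trans (le_abs_self _)) ht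
          (fun τ hτ => hx τ (hτ.2.trans ht₀)) h)
      set t := min (min t₀ T) (t₀ - (D + 1))
      have htt₀ : t ≤ t₀ := (min_le_left _ _).trans (min_le_left _ _)
      have htT : t ≤ T := (min_le_left _ _).trans (min_le_right _ _)
      have htD : t ≤ t₀ - (D + 1) := min_le_right _ _
      have hgrow := image_le_of_deriv_right_le_deriv_boundary (a := t) (b := t₀)
        (f := fun τ => F.X τ s x₀) (f' := fun τ => quadF Q P τ (F.X τ s x₀))
        (B := fun τ => F.X t s x₀ - (τ - t)) (B' := fun _ => -1)
        (fun τ hτ => (hx τ (hτ.2.trans ht₀)).continuousAt.continuousWithinAt)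
        (fun τ hτ => (hx τ (hτ.2.le.trans ht₀)).hasDerivWithinAt) (by simp)
        (by fun_prop)
        (fun τ _ => (((hasDerivAt_id τ).sub_const t).const_sub _).hasDerivWithinAt)
        (fun τ hτ => quadF_le_neg_one hQ hP
          (hKB.trans ((hgt' τ hτ.2.le).le.trans (le_abs_self _))) τ)
        (right_mem_Icc.2 htt₀)
      have h1 := (abs_le.1 (hT t htT).2).2
      linarith
    refine ge_of_tendsto (hylim s) ?_
    filter_upwards [hev s] with n hn
    rw [hyt n s hn.le]
    simpa [F.init] using hcmp (fun τ => F.X τ s x₀) _ s hn.le (fun τ hτ => hx τ hτ.2) (hle _ hn.le)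
  · intro hx₀
    have hup : ∀ t ∈ F.dom s x₀, t ≤ s → F.X t s x₀ ≤ K := by
      intro t ht hts
      rcases hx₀.eq_or_lt with h | h
      · have := (F.maximal s x₀ a univ isOpen_univ ordConnected_univ (mem_univ _) h.symm
          fun t _ => hasol t).2 t (mem_univ _)
        rw [← this]
        exact (abs_le.1 (haK t)).2
      · refine le_trans ?_ (abs_le.1 (haK t)).2
        by_contra! hc
        have := le_of_subsolution_of_supersolution (u := a) (v := fun τ => F.X τ s x₀) hQ hts
          (fun τ _ => hasol τ)
          (fun τ hτ => F.sol s x₀ τ ((F.dom_ordConn s x₀).out ht (F.mem_dom s x₀) hτ))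
          (fun _ _ => le_rfl) (fun _ _ => le_rfl) hc.le
        simp only [F.init] at this
        linarith
    set M := max K (|x₀| + 1) with hM
    have hKM : K ≤ M := le_max_left _ _
    have hxM : |x₀| + 1 ≤ M := le_max_right _ _
    have hlow : ∀ t ∈ F.dom s x₀, t ≤ s → -M ≤ F.X t s x₀ := by
      intro t ht hts
      by_contra! hc
      have := below (fun τ => F.X τ s x₀) (-M) t s
        (by rw [abs_neg]; exact hKB.trans (hKM.trans (le_abs_self _))) hts
        (fun τ hτ => F.sol s x₀ τ ((F.dom_ordConn s x₀).out ht (F.mem_dom s x₀) hτ)) hc.le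
      simp only [F.init] at this
      linarith [neg_abs_le x₀]
    have hbd : ∀ t ∈ F.dom s x₀, t ≤ s → |F.X t s x₀| ≤ M := fun t ht hts =>
      abs_le.2 ⟨hlow t ht hts, (hup t ht hts).trans hKM⟩
    have hd := F.Iic_subset_dom hQc hPc hQ hP hbd
    refine ⟨M, ?_⟩
    filter_upwards [eventually_le_atBot s] with t ht
    exact ⟨hd ht, hbd t (hd ht) ht⟩

lemma HasDerivAt.quadF_reflect {Q P y : ℝ → ℝ} {t : ℝ}
    (h : HasDerivAt y (quadF Q P (-t) (y (-t))) (-t)) :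
    HasDerivAt (fun τ => -y (-τ)) (quadF (fun t => -Q (-t)) (fun t => P (-t)) t (-y (-t))) t := by
  have h1 := (h.comp t (hasDerivAt_neg t)).neg
  refine (h1.congr_deriv ?_).congr_of_eventuallyEq (Eventually.of_forall fun _ => rfl)
  unfold quadF
  ring

/-- The family of maximal solutions of the equation obtained by the change of variables
`(t, x) ↦ (-t, -x)`. -/
def MaxSolFamily.reflect {Q P : ℝ → ℝ} (F : MaxSolFamily (quadF Q P)) :
    MaxSolFamily (quadF (fun t => -Q (-t)) (fun t => P (-t))) where
  X t s x₀ := -F.X (-t) (-s) (-x₀)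
  dom s x₀ := Neg.neg ⁻¹' F.dom (-s) (-x₀)
  dom_open s x₀ := (F.dom_open _ _).preimage continuous_neg
  dom_ordConn s x₀ := ⟨fun _ hx _ hy _ hz =>
    (F.dom_ordConn (-s) (-x₀)).out hy hx ⟨neg_le_neg hz.2, neg_le_neg hz.1⟩⟩
  mem_dom s x₀ := F.mem_dom (-s) (-x₀)
  init s x₀ := by simp [F.init]
  sol s x₀ t ht := HasDerivAt.quadF_reflect (y := fun τ => F.X τ (-s) (-x₀)) (F.sol _ _ _ ht)
  maximal := by
    intro s x₀ y I hI hIo hs hy hsol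
    obtain ⟨h1, h2⟩ := F.maximal (-s) (-x₀) (fun τ => -y (-τ)) (Neg.neg ⁻¹' I)
      (hI.preimage continuous_neg)
      ⟨fun _ hx _ hy _ hz => hIo.out hy hx ⟨neg_le_neg hz.2, neg_le_neg hz.1⟩⟩
      (by simpa using hs) (by simp [hy])
      (fun t ht => by simpa using (hsol (-t) ht).quadF_reflect)
    refine ⟨fun t ht => h1 (by simpa using ht), fun t ht => ?_⟩
    rw [← h2 (-t) (by simpa using ht)]
    simp

lemma CharA.reflect {Q P a : ℝ → ℝ} {F : MaxSolFamily (quadF Q P)} (ha : CharA F.reflect a) :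
    CharR F fun t => -a (-t) := by
  obtain ⟨h1, ⟨C, hC⟩, h3⟩ := ha
  refine ⟨fun t => by simpa using (h1 (-t)).quadF_reflect, ⟨C, fun t => by simpa using hC (-t)⟩,
    fun s x₀ => ?_⟩
  rw [neg_le, ← h3 (-s) (-x₀)]
  refine exists_congr fun D => ?_
  rw [← map_neg_atBot, eventually_map]
  simp [MaxSolFamily.reflect]

/-- An exponentially contracting linear equation has a bounded response to a constant forcing. -/
lemma exists_bounded_solution_linear_of_attractive {A : ℝ → ℝ} (hA : Continuous A) {k β : ℝ}
    (hβ : 0 < β)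
    (h : ∀ s t : ℝ, s ≤ t → Real.exp (∫ l in s..t, A l) ≤ k * Real.exp (-β * (t - s))) :
    ∃ (w : ℝ → ℝ) (D : ℝ), (∀ t, HasDerivAt w (A t * w t + 1) t) ∧ ∀ t, |w t| ≤ D := by
  set E : ℝ → ℝ := fun t => ∫ l in (0 : ℝ)..t, A l with hE
  have hintegral : ∀ s t, IntervalIntegrable A MeasureTheory.volume s t := fun s t =>
    hA.intervalIntegrable s t
  have hEd : ∀ t, HasDerivAt E (A t) t := fun t => intervalIntegral.integral_hasDerivAt_right
    (hintegral _ _) (hA.stronglyMeasurableAtFilter _ _) hA.continuousAt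
  have hEc : Continuous E := continuous_iff_continuousAt.2 fun t => (hEd t).continuousAt
  set g : ℝ → ℝ := fun s => Real.exp (-E s) with hg
  have hgc : Continuous g := by fun_prop
  have hgb : ∀ s t, s ≤ t → g s ≤ Real.exp (-E t) * k * Real.exp (-β * t) * Real.exp (β * s) := by
    intro s t hst
    have h1 : E t - E s = ∫ l in s..t, A l :=
      intervalIntegral.integral_interval_sub_left (hintegral _ _) (hintegral _ _)
    have h2 : g s = Real.exp (-E t) * Real.exp (∫ l in s..t, A l) := by
      rw [← h1, ← Real.exp_add]; exact congrArg Real.exp (by ring)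
    have h3 : Real.exp (-β * (t - s)) = Real.exp (-β * t) * Real.exp (β * s) := by
      rw [← Real.exp_add]; congr 1; ring
    rw [h2]
    calc _ ≤ Real.exp (-E t) * (k * Real.exp (-β * (t - s))) := by gcongr; exact h s t hst
      _ = _ := by rw [h3]; ring
  have hdom : ∀ t, MeasureTheory.IntegrableOn
      (fun s => Real.exp (-E t) * k * Real.exp (-β * t) * Real.exp (β * s)) (Iic t) := fun t =>
    (integrableOn_exp_mul_Iic hβ t).const_mul _
  have hgi : ∀ t, MeasureTheory.IntegrableOn g (Iic t) := fun t => by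
    refine (hdom t).mono' hgc.aestronglyMeasurable ?_
    filter_upwards [MeasureTheory.ae_restrict_mem measurableSet_Iic] with s hs
    rw [Real.norm_of_nonneg (Real.exp_pos _).le]
    exact hgb s t hs
  set G : ℝ → ℝ := fun t => ∫ s in Iic t, g s with hG
  have hGd : ∀ t, HasDerivAt G (g t) t := by
    intro t
    have h1 : G = fun t => G 0 + ∫ s in (0 : ℝ)..t, g s := by
      funext t
      rw [← intervalIntegral.integral_Iic_sub_Iic (hgi 0) (hgi t)]
      simp [hG]
    rw [h1]
    exact (intervalIntegral.integral_hasDerivAt_right (hgc.intervalIntegrable _ _)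
      (hgc.stronglyMeasurableAtFilter _ _) hgc.continuousAt).const_add _
  refine ⟨fun t => Real.exp (E t) * G t, k / β, fun t => ?_, fun t => ?_⟩
  · refine ((hEd t).exp.mul (hGd t)).congr_deriv ?_
    have : Real.exp (E t) * g t = 1 := by rw [hg, ← Real.exp_add]; simp
    rw [this]; ring
  · have hG0 : 0 ≤ G t := MeasureTheory.setIntegral_nonneg measurableSet_Iic
      fun s _ => (Real.exp_pos _).le
    rw [abs_of_nonneg (mul_nonneg (Real.exp_pos _).le hG0)]
    have h1 : G t ≤ Real.exp (-E t) * k * Real.exp (-β * t) * (Real.exp (β * t) / β) := by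
      rw [← integral_exp_mul_Iic hβ t, ← MeasureTheory.integral_const_mul]
      exact MeasureTheory.setIntegral_mono_on (hgi t) (hdom t) measurableSet_Iic
        fun s hs => hgb s t hs
    calc _ ≤ Real.exp (E t) *
          (Real.exp (-E t) * k * Real.exp (-β * t) * (Real.exp (β * t) / β)) := by gcongr
      _ = (Real.exp (E t) * Real.exp (-E t)) * (Real.exp (-β * t) * Real.exp (β * t)) * (k / β) := by
        ring
      _ = k / β := by rw [← Real.exp_add, ← Real.exp_add]; simp

/-- An exponentially expanding linear equation has a bounded response to a constant forcing. -/
lemma exists_bounded_solution_linear_of_repulsive {A : ℝ → ℝ} (hA : Continuous A) {k β : ℝ}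
    (hβ : 0 < β)
    (h : ∀ s t : ℝ, t ≤ s → Real.exp (∫ l in s..t, A l) ≤ k * Real.exp (β * (t - s))) :
    ∃ (w : ℝ → ℝ) (D : ℝ), (∀ t, HasDerivAt w (A t * w t + 1) t) ∧ ∀ t, |w t| ≤ D := by
  obtain ⟨w, D, hw, hD⟩ := exists_bounded_solution_linear_of_attractive (A := fun t => -A (-t))
    (by fun_prop) (k := k) hβ (fun s t hst => by
      have h1 : ∫ l in s..t, -A (-l) = ∫ l in (-s)..(-t), A l := by
        rw [intervalIntegral.integral_neg, intervalIntegral.integral_comp_neg (fun l => A l),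
          intervalIntegral.integral_symm, neg_neg]
      rw [h1]
      refine (h (-s) (-t) (neg_le_neg hst)).trans_eq ?_
      congr 2; ring)
  refine ⟨fun t => -w (-t), D, fun t => ?_, fun t => by simpa using hD (-t)⟩
  have h1 := ((hw (-t)).comp t (hasDerivAt_neg t)).neg
  refine (h1.congr_deriv ?_).congr_of_eventuallyEq (Eventually.of_forall fun _ => rfl)
  simp only [neg_neg]
  ring

theorem stmt13 (q p : ℝ → ℝ)
    (hqb : ∃ C, ∀ t, |q t| ≤ C) (hqu : UniformContinuous q)
    (hpb : ∃ C, ∀ t, |p t| ≤ C) (hpu : UniformContinuous p)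
    (F : ∀ lam : ℝ, MaxSolFamily (quadF q (fun t => p t + lam)))
    (lamstar : ℝ)
    (hstar : ∀ lam : ℝ, (∃ b : ℝ → ℝ, IsBddSol q (fun t => p t + lam) b) ↔ lamstar ≤ lam) :
    ∃ a r : ℝ → ℝ, CharA (F lamstar) a ∧ CharR (F lamstar) r ∧
      -- inf (a − r) = 0
      (∀ t, 0 ≤ a t - r t) ∧ (∀ δ > (0:ℝ), ∃ t : ℝ, a t - r t < δ) ∧
      -- there are no hyperbolic solutions for λ = λ*
      (∀ b : ℝ → ℝ, ¬ IsHyp q (fun t => p t + lamstar) b) := by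
  obtain ⟨Cq, hq⟩ := hqb
  obtain ⟨Cp, hp⟩ := hpb
  have hqc := hqu.continuous
  have hpc : ∀ lam, Continuous fun t => p t + lam := fun lam => hpu.continuous.add continuous_const
  have hqB : ∀ (lam : ℝ) t, |q t| ≤ max Cq (Cp + |lam|) := fun lam t =>
    (hq t).trans (le_max_left _ _)
  have hpB : ∀ (lam : ℝ) t, |p t + lam| ≤ max Cq (Cp + |lam|) := fun lam t =>
    (abs_add_le _ _).trans ((add_le_add_left (hp t) _).trans (le_max_right _ _))
  have hsub : ∀ (lam C : ℝ) (m m' : ℝ → ℝ), (∀ t, HasDerivAt m (m' t) t) →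
      (∀ t, m' t ≤ quadF q (fun t => p t + lam) t (m t)) → (∀ t, |m t| ≤ C) → lamstar ≤ lam := by
    intro lam C m m' hm hm' hmC
    obtain ⟨a, ha, hab, -⟩ := exists_charA_of_subsolution (F lam) hqc (hpc lam) (hqB lam) (hpB lam)
      hm hm' hmC
    exact (hstar lam).1 ⟨a, ha, hab⟩
  obtain ⟨b, hb, C, hbC⟩ := (hstar lamstar).2 le_rfl
  obtain ⟨a, ha⟩ := exists_charA_of_subsolution (F lamstar) hqc (hpc lamstar) (hqB lamstar)
    (hpB lamstar) hb (fun _ => le_rfl) hbC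
  obtain ⟨r, hr⟩ : ∃ r, CharR (F lamstar) r := by
    obtain ⟨a', ha'⟩ := exists_charA_of_subsolution (F lamstar).reflect
      (hqc.comp continuous_neg).neg ((hpc lamstar).comp continuous_neg)
      (fun t => by simpa using hqB lamstar (-t)) (fun t => hpB lamstar (-t))
      (m := fun t => -b (-t)) (fun t => (hb (-t)).quadF_reflect) (fun _ => le_rfl)
      (C := C) (fun t => by simpa using hbC (-t))
    exact ⟨_, ha'.reflect⟩
  refine ⟨a, r, ha, hr, fun t => ?_, fun δ hδ => ?_, fun b' hb' => ?_⟩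
  · have hmax : ∀ s, univ ⊆ (F lamstar).dom s (b s) ∧
        ∀ t ∈ univ, b t = (F lamstar).X t s (b s) := fun s =>
      (F lamstar).maximal s (b s) b univ isOpen_univ ordConnected_univ (mem_univ _) rfl
        fun t _ => hb t
    have hall : ∀ τ, τ ∈ (F lamstar).dom t (b t) ∧ |(F lamstar).X τ t (b t)| ≤ C := fun τ =>
      ⟨(hmax t).1 (mem_univ _), by rw [← (hmax t).2 τ (mem_univ _)]; exact hbC τ⟩
    have h1 : b t ≤ a t := (ha.2.2 t (b t)).1 ⟨C, Eventually.of_forall hall⟩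
    have h2 : r t ≤ b t := (hr.2.2 t (b t)).1 ⟨C, Eventually.of_forall hall⟩
    linarith
  · by_contra! hcon
    obtain ⟨ha1, ⟨Ca, hCa⟩, -⟩ := ha
    obtain ⟨hr1, ⟨Cr, hCr⟩, -⟩ := hr
    have := hsub (lamstar - δ ^ 2 / 4) ((Ca + Cr) / 2) (fun t => (a t + r t) / 2) _
      (fun t => ((ha1 t).add (hr1 t)).div_const 2) (fun t => ?_) (fun t => ?_)
    · nlinarith
    · have h := hcon t
      unfold quadF
      nlinarith
    · have h1 := abs_le.1 (hCa t)
      have h2 := abs_le.1 (hCr t)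
      rw [abs_le]; constructor <;> linarith
  · obtain ⟨⟨hb1, Cb, hCb⟩, w, D, hw, hwD⟩ : IsBddSol q (fun t => p t + lamstar) b' ∧
        ∃ (w : ℝ → ℝ) (D : ℝ), (∀ t, HasDerivAt w ((-2 * b' t + q t) * w t + 1) t) ∧
          ∀ t, |w t| ≤ D := by
      rcases hb' with ⟨h, k, β, -, hβ, hd⟩ | ⟨h, k, β, -, hβ, hd⟩
      · have hbc : Continuous b' := continuous_iff_continuousAt.2 fun t => (h.1 t).continuousAt
        exact ⟨h, exists_bounded_solution_linear_of_attractive (by fun_prop) hβ hd⟩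
      · have hbc : Continuous b' := continuous_iff_continuousAt.2 fun t => (h.1 t).continuousAt
        exact ⟨h, exists_bounded_solution_linear_of_repulsive (by fun_prop) hβ hd⟩
    set η := 1 / (2 * D ^ 2 + 1) with hη
    have hη0 : 0 < η := by positivity
    have hηD : η * (2 * D ^ 2 + 1) = 1 := by rw [hη]; field_simp
    have := hsub (lamstar - η / 2) (Cb + η * D) (fun t => b' t - η * w t) _
      (fun t => (hb1 t).sub ((hw t).const_mul η)) (fun t => ?_) (fun t => ?_)
    · linarith
    · have h1 : w t ^ 2 ≤ D ^ 2 := sq_le_sq' (abs_le.1 (hwD t)).1 (abs_le.1 (hwD t)).2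
      have h2 : η * (η * w t ^ 2) ≤ η * (1 / 2) := by
        gcongr
        nlinarith
      unfold quadF
      nlinarith
    · calc |b' t - η * w t| ≤ |b' t| + |η * w t| := abs_sub _ _
        _ ≤ Cb + η * D := by
          rw [abs_mul, abs_of_pos hη0]
          gcongr
          · exact hCb t
          · exact hwD t
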